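/- arXiv:2308.13193 — 2 statements merged into one kernel-verified Lean document; each statement's English description precedes it below -/
import Mathlib

section
/- (Kesten's method.) Let d ≥ 2 and let M = (μ_A)_{A finite ⊆ ℤ^d} be a family of probability measures with μ_A supported on A. Suppose there exist constants C > 0 and q > 0 such that for every real r > 1, every B ∈ P^d_∂ with rad(B) ≥ r, and every z ∈ B, one has μ_B({z}) ≤ C·r^{−q}. Let (F_n)_{n∈ℕ} be incremental aggregation with distribution family M. Then there exists a constant c > 0 such that ℙ( there exists N ∈ ℕ such that for all n ≥ N, rad(F_n) ≤ c·n^{1/(q+1)} ) = 1. -/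
open MeasureTheory Filter

/-- Euclidean norm of a lattice point. -/
noncomputable def zNorm {d : ℕ} (x : Fin d → ℤ) : ℝ :=
  Real.sqrt (∑ i, ((x i : ℝ)) ^ 2)

/-- Two lattice points are adjacent (nearest neighbours) if their Euclidean distance is 1. -/
def adjPt {d : ℕ} (x y : Fin d → ℤ) : Prop := zNorm (x - y) = 1

/-- The radius of a finite set: the maximal Euclidean norm of its points. -/
noncomputable def rad {d : ℕ} (A : Finset (Fin d → ℤ)) : ℝ :=
  if h : A.Nonempty then A.sup' h zNorm else 0

/-- A finite set is connected in the nearest-neighbour graph on `ℤ^d`. -/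
def IsConnCluster {d : ℕ} (A : Finset (Fin d → ℤ)) : Prop :=
  ∀ x ∈ A, ∀ y ∈ A,
    Relation.ReflTransGen (fun a b => a ∈ A ∧ b ∈ A ∧ adjPt a b) x y

/-- The outer boundary of a set `A ⊆ ℤ^d`: the points outside `A` adjacent to a point of `A`. -/
def obdry {d : ℕ} (A : Set (Fin d → ℤ)) : Set (Fin d → ℤ) :=
  {y | y ∉ A ∧ ∃ x ∈ A, adjPt x y}

/-- `B ∈ P^d_∂`: `B` is the outer boundary of some finite connected set containing `0`. -/
def IsOuterBdry {d : ℕ} (B : Finset (Fin d → ℤ)) : Prop :=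
  ∃ A : Finset (Fin d → ℤ), IsConnCluster A ∧ (0 : Fin d → ℤ) ∈ A ∧
    (B : Set (Fin d → ℤ)) = obdry (A : Set (Fin d → ℤ))

/-- A family of probability distributions `μ_A` supported on `A`,
for each finite nonempty `A ⊆ ℤ^d`. -/
def IsDistFamily {d : ℕ} (μ : Set (Fin d → ℤ) → (Fin d → ℤ) → ℝ) : Prop :=
  ∀ A : Set (Fin d → ℤ), A.Finite → A.Nonempty →
    (∀ z, 0 ≤ μ A z) ∧ (∀ z, z ∉ A → μ A z = 0) ∧ (∑' z, μ A z = 1)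

/-- `(F_n)` with attachment points `(y_n)` is incremental aggregation with distribution
family `μ`: `F_1 = {0}` and `y_1 = 0` a.s., `F_{n+1} = F_n ∪ {y_{n+1}}`, and given
`F_n = A` the point `y_{n+1}` is distributed according to `μ_{∂A}`. -/
def IsIncrementalAggregation {d : ℕ} {Ω : Type*} [MeasurableSpace Ω]
    (P : Measure Ω) (μ : Set (Fin d → ℤ) → (Fin d → ℤ) → ℝ)
    (F : ℕ → Ω → Finset (Fin d → ℤ)) (y : ℕ → Ω → (Fin d → ℤ)) : Prop :=
  (∀ᵐ ω ∂P, F 1 ω = {0} ∧ y 1 ω = 0) ∧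
  (∀ n : ℕ, 1 ≤ n → ∀ ω, F (n + 1) ω = insert (y (n + 1) ω) (F n ω)) ∧
  (∀ n : ℕ, 1 ≤ n → ∀ A : Finset (Fin d → ℤ), ∀ v : Fin d → ℤ,
    P ({ω | y (n + 1) ω = v} ∩ {ω | F n ω = A}) =
      ENNReal.ofReal (μ (obdry (A : Set (Fin d → ℤ))) v) * P {ω | F n ω = A})

lemma zNorm_eq {d : ℕ} (x : Fin d → ℤ) :
    zNorm x = ‖(WithLp.toLp 2 (fun i => (x i : ℝ)) : EuclideanSpace ℝ (Fin d))‖ := by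
  rw [EuclideanSpace.norm_eq]
  simp [zNorm]

lemma zNorm_le_of_adj {d : ℕ} {x v : Fin d → ℤ} (h : adjPt x v) : zNorm v ≤ zNorm x + 1 := by
  unfold adjPt at h
  rw [zNorm_eq] at h
  rw [zNorm_eq, zNorm_eq, ← h]
  have e : (WithLp.toLp 2 (fun i => ((x - v) i : ℝ)) : EuclideanSpace ℝ (Fin d)) =
      WithLp.toLp 2 (fun i => (x i : ℝ)) - WithLp.toLp 2 (fun i => (v i : ℝ)) := by
    ext i; simp
  rw [e, add_comm, norm_sub_rev]
  exact norm_le_norm_sub_add _ _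

lemma adjPt_symm {d : ℕ} {x v : Fin d → ℤ} (h : adjPt x v) : adjPt v x := by
  unfold adjPt zNorm at *
  rw [← h]
  congr 1
  apply Finset.sum_congr rfl
  intro i _
  simp only [Pi.sub_apply]
  push_cast
  ring

lemma unit_finite (d : ℕ) : {w : Fin d → ℤ | zNorm w = 1}.Finite := by
  apply (Set.finite_Icc (fun _ => -1 : Fin d → ℤ) (fun _ => 1)).subset
  intro w hw
  have hw : zNorm w = 1 := hw
  have h1 : ∑ i, ((w i : ℝ)) ^ 2 = 1 := by
    unfold zNorm at hw
    exact Real.sqrt_eq_one.1 hw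
  have h2 : ∀ i, |w i| ≤ 1 := by
    intro i
    have : ((w i : ℝ)) ^ 2 ≤ 1 := by
      rw [← h1]
      exact Finset.single_le_sum (f := fun i => ((w i : ℝ)) ^ 2)
        (fun j _ => sq_nonneg _) (Finset.mem_univ i)
    have h3 : (w i) ^ 2 ≤ 1 := by exact_mod_cast this
    exact (sq_le_one_iff_abs_le_one _).1 h3
  exact ⟨fun i => (abs_le.1 (h2 i)).1, fun i => (abs_le.1 (h2 i)).2⟩

/-- The finite set of unit lattice vectors. -/
noncomputable def unitSet (d : ℕ) : Finset (Fin d → ℤ) := (unit_finite d).toFinset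

lemma adj_mem {d : ℕ} {x v : Fin d → ℤ} (h : adjPt x v) : x - v ∈ unitSet d := by
  simpa [unitSet, adjPt] using h

lemma obdry_finite {d : ℕ} (A : Finset (Fin d → ℤ)) : (obdry (A : Set (Fin d → ℤ))).Finite := by
  apply ((A.product (unitSet d)).image (fun p => p.1 - p.2)).finite_toSet.subset
  rintro v ⟨_, x, hx, hxv⟩
  simp only [Finset.coe_image, Set.mem_image]
  exact ⟨(x, x - v), Finset.mem_coe.2 (Finset.mem_product.2 ⟨hx, adj_mem hxv⟩), by simp⟩

lemma obdry_nonempty {d : ℕ} (hd : 2 ≤ d) (A : Finset (Fin d → ℤ)) (hA : A.Nonempty) :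
    (obdry (A : Set (Fin d → ℤ))).Nonempty := by
  let i0 : Fin d := ⟨0, by omega⟩
  obtain ⟨x, hx, hmax⟩ := A.exists_max_image (fun x => x i0) hA
  refine ⟨x + Pi.single i0 1, ?_, x, hx, ?_⟩
  · intro h
    have := hmax _ h
    simp at this
  · simp only [adjPt, zNorm]
    rw [Real.sqrt_eq_one]
    rw [Finset.sum_eq_single i0]
    · simp
    · intro j _ hj; simp [hj]
    · simp

/-- Connected and containing the origin. -/
def Good {d : ℕ} (A : Finset (Fin d → ℤ)) : Prop := IsConnCluster A ∧ (0 : Fin d → ℤ) ∈ A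

lemma good_zero {d : ℕ} : Good ({0} : Finset (Fin d → ℤ)) := by
  refine ⟨?_, by simp⟩
  intro x hx y hy
  rw [Finset.mem_singleton] at hx hy
  subst hx; subst hy
  exact Relation.ReflTransGen.refl

lemma good_insert {d : ℕ} {A : Finset (Fin d → ℤ)} (hA : Good A) {v : Fin d → ℤ}
    (hv : v ∈ obdry (A : Set (Fin d → ℤ))) : Good (insert v A) := by
  obtain ⟨_, x, hx, hxv⟩ := hv
  have hx : x ∈ A := hx
  refine ⟨?_, Finset.mem_insert_of_mem hA.2⟩
  have lift : ∀ a ∈ A, ∀ b ∈ A, Relation.ReflTransGen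
      (fun a b => a ∈ insert v A ∧ b ∈ insert v A ∧ adjPt a b) a b := by
    intro a ha b hb
    refine Relation.ReflTransGen.mono ?_ _ _ (hA.1 a ha b hb)
    rintro a b ⟨h1, h2, h3⟩
    exact ⟨Finset.mem_insert_of_mem h1, Finset.mem_insert_of_mem h2, h3⟩
  have hxm := Finset.mem_insert_of_mem (b := v) hx
  have hvm := Finset.mem_insert_self v A
  intro a ha b hb
  rcases Finset.mem_insert.1 ha with ha' | ha' <;>
    rcases Finset.mem_insert.1 hb with hb' | hb'
  · rw [ha', hb']
  · rw [ha']
    exact Relation.ReflTransGen.head ⟨hvm, hxm, adjPt_symm hxv⟩ (lift _ hx _ hb')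
  · rw [hb']
    exact Relation.ReflTransGen.tail (lift _ ha' _ hx) ⟨hxm, hvm, hxv⟩
  · exact lift _ ha' _ hb'

lemma dist_props {d : ℕ} (hd : 2 ≤ d) {μ : Set (Fin d → ℤ) → (Fin d → ℤ) → ℝ}
    (hμ : IsDistFamily μ) (A : Finset (Fin d → ℤ)) (hA : A.Nonempty) :
    (∑' v, ENNReal.ofReal (μ (obdry (A : Set (Fin d → ℤ))) v) = 1) ∧
    (∀ v, v ∉ obdry (A : Set (Fin d → ℤ)) → μ (obdry (A : Set (Fin d → ℤ))) v = 0) := by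
  obtain ⟨h1, h2, h3⟩ := hμ _ (obdry_finite A) (obdry_nonempty hd A hA)
  refine ⟨?_, h2⟩
  have hs : Summable (μ (obdry (A : Set (Fin d → ℤ)))) := by
    by_contra h
    rw [tsum_eq_zero_of_not_summable h] at h3
    norm_num at h3
  rw [← ENNReal.ofReal_tsum_of_nonneg h1 hs, h3, ENNReal.ofReal_one]

/-- One-step inequality for the laws, valid with outer measures. -/
lemma step_le {d : ℕ} {Ω : Type*} [MeasurableSpace Ω]
    (P : Measure Ω) (μ : Set (Fin d → ℤ) → (Fin d → ℤ) → ℝ)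
    (F : ℕ → Ω → Finset (Fin d → ℤ)) (y : ℕ → Ω → (Fin d → ℤ))
    (hagg : IsIncrementalAggregation P μ F y) (n : ℕ) (hn : 1 ≤ n)
    (G : Finset (Fin d → ℤ) → ENNReal) :
    ∑' A, P {ω | F (n + 1) ω = A} * G A ≤
      ∑' A, P {ω | F n ω = A} *
        ∑' v, ENNReal.ofReal (μ (obdry (A : Set (Fin d → ℤ))) v) * G (insert v A) := by
  obtain ⟨_, h2, h3⟩ := hagg
  have key : ∀ A', P {ω | F (n + 1) ω = A'} ≤
      ∑' p : Finset (Fin d → ℤ) × (Fin d → ℤ), if A' = insert p.2 p.1 then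
        P ({ω | y (n + 1) ω = p.2} ∩ {ω | F n ω = p.1}) else 0 := by
    intro A'
    calc P {ω | F (n + 1) ω = A'} ≤ P (⋃ p : Finset (Fin d → ℤ) × (Fin d → ℤ),
          if A' = insert p.2 p.1 then
            ({ω | y (n + 1) ω = p.2} ∩ {ω | F n ω = p.1}) else ∅) := by
          apply measure_mono
          intro ω hω
          have hω : F (n + 1) ω = A' := hω
          rw [Set.mem_iUnion]
          refine ⟨(F n ω, y (n + 1) ω), ?_⟩
          rw [if_pos (by rw [← hω, h2 n hn ω])]
          exact ⟨rfl, rfl⟩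
      _ ≤ _ := by
          refine (measure_iUnion_le _).trans (ENNReal.tsum_le_tsum fun p => ?_)
          split_ifs <;> simp
  calc ∑' A, P {ω | F (n + 1) ω = A} * G A
      ≤ ∑' A', ∑' p : Finset (Fin d → ℤ) × (Fin d → ℤ), (if A' = insert p.2 p.1 then
        P ({ω | y (n + 1) ω = p.2} ∩ {ω | F n ω = p.1}) else 0) * G A' := by
        refine ENNReal.tsum_le_tsum fun A' => ?_
        rw [ENNReal.tsum_mul_right]
        exact mul_le_mul_left (key A') _
    _ = ∑' p : Finset (Fin d → ℤ) × (Fin d → ℤ),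
        P ({ω | y (n + 1) ω = p.2} ∩ {ω | F n ω = p.1}) * G (insert p.2 p.1) := by
        rw [ENNReal.tsum_comm]
        refine tsum_congr fun p => ?_
        rw [tsum_eq_single (insert p.2 p.1)]
        · rw [if_pos rfl]
        · intro A' hA'
          rw [if_neg hA', zero_mul]
    _ = ∑' A, P {ω | F n ω = A} *
        ∑' v, ENNReal.ofReal (μ (obdry (A : Set (Fin d → ℤ))) v) * G (insert v A) := by
        rw [ENNReal.tsum_prod (f := fun A v =>
          P ({ω | y (n + 1) ω = v} ∩ {ω | F n ω = A}) * G (insert v A))]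
        refine tsum_congr fun A => ?_
        rw [← ENNReal.tsum_mul_left]
        refine tsum_congr fun v => ?_
        rw [h3 n hn A v]
        ring

lemma first_le {d : ℕ} {Ω : Type*} [MeasurableSpace Ω]
    (P : Measure Ω) [IsProbabilityMeasure P] (μ : Set (Fin d → ℤ) → (Fin d → ℤ) → ℝ)
    (F : ℕ → Ω → Finset (Fin d → ℤ)) (y : ℕ → Ω → (Fin d → ℤ))
    (hagg : IsIncrementalAggregation P μ F y)
    (G : Finset (Fin d → ℤ) → ENNReal) :
    ∑' A, P {ω | F 1 ω = A} * G A ≤ G {0} := by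
  rw [tsum_eq_single {0}]
  · calc _ ≤ 1 * G {0} := mul_le_mul_left prob_le_one _
      _ = _ := one_mul _
  · intro A hA
    have : P {ω | F 1 ω = A} = 0 := by
      refine measure_mono_null ?_ (ae_iff.1 hagg.1)
      intro ω hω h
      exact hA (hω.symm.trans h.1)
    rw [this, zero_mul]

lemma good_law {d : ℕ} (hd : 2 ≤ d) {Ω : Type*} [MeasurableSpace Ω]
    (P : Measure Ω) [IsProbabilityMeasure P] (μ : Set (Fin d → ℤ) → (Fin d → ℤ) → ℝ)
    (hμ : IsDistFamily μ)
    (F : ℕ → Ω → Finset (Fin d → ℤ)) (y : ℕ → Ω → (Fin d → ℤ))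
    (hagg : IsIncrementalAggregation P μ F y) (n : ℕ) (hn : 1 ≤ n) :
    ∀ A, ¬ Good A → P {ω | F n ω = A} = 0 := by
  classical
  suffices h : ∑' A, P {ω | F n ω = A} * (if Good A then 0 else 1) = 0 by
    intro A hA
    have := ENNReal.tsum_eq_zero.1 h A
    simpa [hA] using this
  induction n, hn using Nat.le_induction with
  | base =>
    refine le_antisymm ((first_le P μ F y hagg _).trans ?_) (zero_le)
    rw [if_pos good_zero]
  | succ n hn ih =>
    refine le_antisymm ((step_le P μ F y hagg n hn _).trans ?_) (zero_le)
    rw [nonpos_iff_eq_zero, ENNReal.tsum_eq_zero]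
    intro A
    by_cases hA : Good A
    · rw [mul_eq_zero]; right
      rw [ENNReal.tsum_eq_zero]
      intro v
      by_cases hv : v ∈ obdry (A : Set (Fin d → ℤ))
      · rw [if_pos (good_insert hA hv), mul_zero]
      · rw [(dist_props hd hμ A ⟨0, hA.2⟩).2 v hv]; simp
    · have := ENNReal.tsum_eq_zero.1 ih A
      rw [if_neg hA, mul_one] at this
      rw [this, zero_mul]

lemma mass_le {d : ℕ} (hd : 2 ≤ d) {Ω : Type*} [MeasurableSpace Ω]
    (P : Measure Ω) [IsProbabilityMeasure P] (μ : Set (Fin d → ℤ) → (Fin d → ℤ) → ℝ)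
    (hμ : IsDistFamily μ)
    (F : ℕ → Ω → Finset (Fin d → ℤ)) (y : ℕ → Ω → (Fin d → ℤ))
    (hagg : IsIncrementalAggregation P μ F y) (n : ℕ) (hn : 1 ≤ n) :
    ∑' A, P {ω | F n ω = A} ≤ 1 := by
  induction n, hn using Nat.le_induction with
  | base => simpa using first_le P μ F y hagg (fun _ => 1)
  | succ n hn ih =>
    have := step_le P μ F y hagg n hn (fun _ => 1)
    simp only [mul_one] at this
    refine this.trans (le_trans (ENNReal.tsum_le_tsum fun A => ?_) ih)
    by_cases hA : Good A
    · rw [(dist_props hd hμ A ⟨0, hA.2⟩).1, mul_one]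
    · rw [good_law hd P μ hμ F y hagg n hn A hA, zero_mul]

/-- The exponential site weight, truncated at radius `r`. -/
noncomputable def wt {d : ℕ} (r : ℝ) (x : Fin d → ℤ) : ENNReal :=
  ENNReal.ofReal (Real.exp (max (zNorm x) r))

lemma wt_adj {d : ℕ} {r : ℝ} {x v : Fin d → ℤ} (h : adjPt x v) :
    wt r v ≤ ENNReal.ofReal (Real.exp 1) * wt r x := by
  unfold wt
  rw [← ENNReal.ofReal_mul (Real.exp_nonneg _), ← Real.exp_add]
  apply ENNReal.ofReal_le_ofReal
  apply Real.exp_le_exp.2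
  have := zNorm_le_of_adj h
  apply max_le
  · linarith [le_max_left (zNorm x) r]
  · linarith [le_max_right (zNorm x) r]

lemma le_rad {d : ℕ} {B : Finset (Fin d → ℤ)} {z : Fin d → ℤ} (hz : z ∈ B) :
    zNorm z ≤ rad B := by
  unfold rad
  rw [dif_pos ⟨z, hz⟩]
  exact Finset.le_sup' zNorm hz

lemma wt_step {d : ℕ} (hd : 2 ≤ d)
    (μ : Set (Fin d → ℤ) → (Fin d → ℤ) → ℝ) (hμ : IsDistFamily μ)
    (C q : ℝ)
    (hBeurling : ∀ r : ℝ, 1 < r → ∀ B : Finset (Fin d → ℤ), IsOuterBdry B →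
      r ≤ rad B → ∀ z ∈ B, μ (B : Set (Fin d → ℤ)) z ≤ C * r ^ (-q))
    (r : ℝ) (hr : 1 < r) (A : Finset (Fin d → ℤ)) (hA : Good A) :
    ∑' v, ENNReal.ofReal (μ (obdry (A : Set (Fin d → ℤ))) v) * wt r v ≤
      ENNReal.ofReal (Real.exp r) + ENNReal.ofReal (C * r ^ (-q)) *
        ((unitSet d).card * (ENNReal.ofReal (Real.exp 1) * ∑ x ∈ A, wt r x)) := by
  classical
  obtain ⟨hp1, hp2⟩ := dist_props hd hμ A ⟨0, hA.2⟩
  set m : (Fin d → ℤ) → ENNReal :=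
    fun v => ENNReal.ofReal (μ (obdry (A : Set (Fin d → ℤ))) v) with hm
  have hbeta : ∀ v ∈ obdry (A : Set (Fin d → ℤ)), r ≤ zNorm v →
      m v ≤ ENNReal.ofReal (C * r ^ (-q)) := by
    intro v hv hrv
    apply ENNReal.ofReal_le_ofReal
    have hB := hBeurling r hr (obdry_finite A).toFinset ⟨A, hA.1, hA.2, by simp⟩
      (hrv.trans (le_rad (by simpa using hv))) v (by simpa using hv)
    simpa using hB
  have pt : ∀ v, m v * wt r v ≤ m v * ENNReal.ofReal (Real.exp r) +
      ENNReal.ofReal (C * r ^ (-q)) * ∑ x ∈ A,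
        (if x - v ∈ unitSet d then (ENNReal.ofReal (Real.exp 1) * wt r x) else 0) := by
    intro v
    by_cases hv : v ∈ obdry (A : Set (Fin d → ℤ))
    · by_cases hrv : r ≤ zNorm v
      · obtain ⟨_, x, hx, hxv⟩ := id hv
        refine le_trans ?_ le_add_self
        refine mul_le_mul' (hbeta v hv hrv) ((wt_adj hxv).trans ?_)
        have := Finset.single_le_sum (f := fun x => (if x - v ∈ unitSet d then
          (ENNReal.ofReal (Real.exp 1) * wt r x) else 0)) (fun _ _ => zero_le)
          (Finset.mem_coe.1 hx)
        simpa only [if_pos (adj_mem hxv)] using this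
      · refine le_trans ?_ le_self_add
        have : wt r v = ENNReal.ofReal (Real.exp r) := by
          unfold wt; rw [max_eq_right (le_of_not_ge hrv)]
        rw [this]
    · simp [hm, hp2 v hv]
  refine (ENNReal.tsum_le_tsum pt).trans ?_
  rw [ENNReal.tsum_add, ENNReal.tsum_mul_right, hp1, one_mul, ENNReal.tsum_mul_left]
  gcongr
  rw [Summable.tsum_finsetSum (fun _ _ => ENNReal.summable), Finset.mul_sum, Finset.mul_sum]
  refine Finset.sum_le_sum fun x _ => ?_
  rw [← (Equiv.subLeft x).tsum_eq]
  simp only [Equiv.subLeft_apply, sub_sub_cancel]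
  rw [tsum_eq_sum (s := unitSet d) (by intro b hb; rw [if_neg hb])]
  rw [Finset.sum_congr rfl (fun b hb => if_pos hb)]
  simp

lemma expect_le {d : ℕ} (hd : 2 ≤ d) {Ω : Type*} [MeasurableSpace Ω]
    (P : Measure Ω) [IsProbabilityMeasure P]
    (μ : Set (Fin d → ℤ) → (Fin d → ℤ) → ℝ) (hμ : IsDistFamily μ)
    (C q : ℝ) (hC : 0 < C)
    (hBeurling : ∀ r : ℝ, 1 < r → ∀ B : Finset (Fin d → ℤ), IsOuterBdry B →
      r ≤ rad B → ∀ z ∈ B, μ (B : Set (Fin d → ℤ)) z ≤ C * r ^ (-q))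
    (F : ℕ → Ω → Finset (Fin d → ℤ)) (y : ℕ → Ω → (Fin d → ℤ))
    (hagg : IsIncrementalAggregation P μ F y) (r : ℝ) (hr : 1 < r) (n : ℕ) (hn : 1 ≤ n) :
    ∑' A, P {ω | F n ω = A} * ∑ x ∈ A, wt r x ≤ ENNReal.ofReal
      (n * (Real.exp r * (1 + C * r ^ (-q) * ((unitSet d).card * Real.exp 1)) ^ n)) := by
  set b : ℝ := C * r ^ (-q) * ((unitSet d).card * Real.exp 1) with hb
  have hb0 : 0 ≤ b := by positivity
  induction n, hn using Nat.le_induction with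
  | base =>
    refine (first_le P μ F y hagg _).trans ?_
    rw [Finset.sum_singleton]
    unfold wt
    apply ENNReal.ofReal_le_ofReal
    have : zNorm (0 : Fin d → ℤ) = 0 := by simp [zNorm]
    rw [this, max_eq_right (by linarith)]
    simp
    nlinarith [Real.exp_pos r]
  | succ n hn ih =>
    set X := ∑' A, P {ω | F n ω = A} * ∑ x ∈ A, wt r x with hX
    have h1 : ∑' A, P {ω | F (n + 1) ω = A} * ∑ x ∈ A, wt r x ≤
        X + (ENNReal.ofReal (Real.exp r) + ENNReal.ofReal b * X) := by
      refine (step_le P μ F y hagg n hn _).trans ?_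
      calc _ ≤ ∑' A, (P {ω | F n ω = A} * ∑ x ∈ A, wt r x +
            (P {ω | F n ω = A} * ENNReal.ofReal (Real.exp r) +
              ENNReal.ofReal b * (P {ω | F n ω = A} * ∑ x ∈ A, wt r x))) := by
            refine ENNReal.tsum_le_tsum fun A => ?_
            by_cases hA : Good A
            · have h2 := wt_step hd μ hμ C q hBeurling r hr A hA
              have hp1 := (dist_props hd hμ A ⟨0, hA.2⟩).1
              have hbb : ENNReal.ofReal b = ENNReal.ofReal (C * r ^ (-q)) *
                  ((unitSet d).card * ENNReal.ofReal (Real.exp 1)) := by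
                rw [hb, ENNReal.ofReal_mul (by positivity),
                  ENNReal.ofReal_mul (p := ((unitSet d).card : ℝ)) (by positivity),
                  ENNReal.ofReal_natCast]
              have h3 : ∑' v, ENNReal.ofReal (μ (obdry (A : Set (Fin d → ℤ))) v) *
                  ∑ x ∈ insert v A, wt r x ≤ ∑ x ∈ A, wt r x +
                    (ENNReal.ofReal (Real.exp r) + ENNReal.ofReal b * ∑ x ∈ A, wt r x) := by
                calc _ ≤ ∑' v, (ENNReal.ofReal (μ (obdry (A : Set (Fin d → ℤ))) v) *
                      ∑ x ∈ A, wt r x +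
                      ENNReal.ofReal (μ (obdry (A : Set (Fin d → ℤ))) v) * wt r v) := by
                      refine ENNReal.tsum_le_tsum fun v => ?_
                      rw [← mul_add]
                      gcongr
                      by_cases hv : v ∈ A
                      · rw [Finset.insert_eq_of_mem hv]; exact le_self_add
                      · rw [Finset.sum_insert hv, add_comm]
                  _ ≤ _ := by
                      rw [ENNReal.tsum_add, ENNReal.tsum_mul_right, hp1, one_mul]
                      gcongr
                      refine h2.trans (le_of_eq ?_)
                      rw [hbb]; ring
              refine (mul_le_mul_right h3 _).trans (le_of_eq ?_)
              ring
            · rw [good_law hd P μ hμ F y hagg n hn A hA]; simp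
        _ ≤ _ := by
            rw [ENNReal.tsum_add, ENNReal.tsum_add, ENNReal.tsum_mul_right,
              ENNReal.tsum_mul_left, ← hX]
            gcongr
            calc _ ≤ 1 * ENNReal.ofReal (Real.exp r) :=
                  mul_le_mul_left (mass_le hd P μ hμ F y hagg n hn) _
              _ = _ := one_mul _
    refine h1.trans ?_
    calc _ ≤ ENNReal.ofReal (n * (Real.exp r * (1 + b) ^ n)) + (ENNReal.ofReal (Real.exp r) +
          ENNReal.ofReal b * ENNReal.ofReal (n * (Real.exp r * (1 + b) ^ n))) := by gcongr
      _ ≤ _ := by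
          rw [← ENNReal.ofReal_mul hb0, ← ENNReal.ofReal_add (by positivity) (by positivity),
            ← ENNReal.ofReal_add (by positivity) (by positivity)]
          apply ENNReal.ofReal_le_ofReal
          have h5 : 1 ≤ (1 + b) ^ (n + 1) := one_le_pow₀ (by linarith)
          have h6 := Real.exp_pos r
          have : ((n + 1 : ℕ) : ℝ) * (Real.exp r * (1 + b) ^ (n + 1)) =
            n * (Real.exp r * (1 + b) ^ n) + (Real.exp r * (1 + b) ^ (n + 1) +
              b * (n * (Real.exp r * (1 + b) ^ n))) := by push_cast; ring
          rw [this]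
          gcongr
          nlinarith

lemma tail_le {d : ℕ} (hd : 2 ≤ d) {Ω : Type*} [MeasurableSpace Ω]
    (P : Measure Ω) [IsProbabilityMeasure P]
    (μ : Set (Fin d → ℤ) → (Fin d → ℤ) → ℝ) (hμ : IsDistFamily μ)
    (C q : ℝ) (hC : 0 < C)
    (hBeurling : ∀ r : ℝ, 1 < r → ∀ B : Finset (Fin d → ℤ), IsOuterBdry B →
      r ≤ rad B → ∀ z ∈ B, μ (B : Set (Fin d → ℤ)) z ≤ C * r ^ (-q))
    (F : ℕ → Ω → Finset (Fin d → ℤ)) (y : ℕ → Ω → (Fin d → ℤ))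
    (hagg : IsIncrementalAggregation P μ F y) (r : ℝ) (hr : 1 < r) (n : ℕ) (hn : 1 ≤ n)
    (R : ℝ) (hR : 0 ≤ R) :
    P {ω | R < rad (F n ω)} ≤ ENNReal.ofReal (n * Real.exp
      (r - R + n * (C * r ^ (-q) * ((unitSet d).card * Real.exp 1)))) := by
  set b : ℝ := C * r ^ (-q) * ((unitSet d).card * Real.exp 1) with hb
  have hb0 : 0 ≤ b := by positivity
  have h0 := expect_le hd P μ hμ C q hC hBeurling F y hagg r hr n hn
  rw [← hb] at h0
  calc P {ω | R < rad (F n ω)}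
      ≤ P (⋃ A : Finset (Fin d → ℤ), if R < rad A then {ω | F n ω = A} else ∅) := by
        apply measure_mono
        intro ω hω
        have hω : R < rad (F n ω) := hω
        rw [Set.mem_iUnion]
        refine ⟨F n ω, ?_⟩
        rw [if_pos hω]
        rfl
    _ ≤ ∑' A, ENNReal.ofReal (Real.exp (-R)) * (P {ω | F n ω = A} * ∑ x ∈ A, wt r x) := by
        refine (measure_iUnion_le _).trans (ENNReal.tsum_le_tsum fun A => ?_)
        split_ifs with hA
        · have hne : A.Nonempty := by
            by_contra h
            rw [rad, dif_neg h] at hA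
            linarith
          rw [rad, dif_pos hne, Finset.lt_sup'_iff] at hA
          obtain ⟨x, hx, hxR⟩ := hA
          have h1 : ENNReal.ofReal (Real.exp R) ≤ ∑ x ∈ A, wt r x := by
            refine le_trans ?_ (Finset.single_le_sum (f := wt r) (fun _ _ => zero_le) hx)
            apply ENNReal.ofReal_le_ofReal
            exact Real.exp_le_exp.2 (hxR.le.trans (le_max_left _ _))
          calc P {ω | F n ω = A} = ENNReal.ofReal (Real.exp (-R)) *
                (P {ω | F n ω = A} * ENNReal.ofReal (Real.exp R)) := by
                rw [mul_comm (P _), ← mul_assoc, ← ENNReal.ofReal_mul (Real.exp_nonneg _),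
                  ← Real.exp_add]
                simp
            _ ≤ _ := by gcongr
        · simp
    _ ≤ ENNReal.ofReal (Real.exp (-R)) *
        ENNReal.ofReal (n * (Real.exp r * (1 + b) ^ n)) := by
        rw [ENNReal.tsum_mul_left]
        gcongr
    _ ≤ _ := by
        rw [← ENNReal.ofReal_mul (Real.exp_nonneg _)]
        apply ENNReal.ofReal_le_ofReal
        have h1 : (1 + b) ^ n ≤ Real.exp (n * b) := by
          rw [Real.exp_nat_mul]
          gcongr
          linarith [Real.add_one_le_exp b]
        rw [Real.exp_add, sub_eq_add_neg, Real.exp_add]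
        calc _ = n * (Real.exp r * Real.exp (-R) * (1 + b) ^ n) := by ring
          _ ≤ _ := by gcongr

lemma summable_aux (q : ℝ) (hq : 0 < q) :
    Summable (fun n : ℕ => (n : ℝ) * Real.exp (-((n : ℝ) ^ ((1 : ℝ) / (q + 1))))) := by
  obtain ⟨k, hk⟩ := exists_nat_ge (3 * (q + 1))
  have hs : Summable (fun n : ℕ => (k.factorial : ℝ) * (1 / (n : ℝ) ^ 2)) :=
    (Real.summable_one_div_nat_pow.2 (by norm_num)).mul_left _
  refine Summable.of_nonneg_of_le (fun n => by positivity) (fun n => ?_) hs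
  rcases Nat.eq_zero_or_pos n with rfl | hn
  · simp
  have hn1 : (1 : ℝ) ≤ n := by exact_mod_cast hn
  set t : ℝ := (n : ℝ) ^ ((1 : ℝ) / (q + 1)) with ht
  have ht1 : 1 ≤ t := Real.one_le_rpow hn1 (by positivity)
  have h1 := Real.pow_div_factorial_le_exp t (by linarith) k
  have h2 : (n : ℝ) ^ 3 ≤ t ^ k := by
    calc (n : ℝ) ^ 3 = t ^ (3 * (q + 1)) := by
          rw [ht, ← Real.rpow_mul (by positivity), ← Real.rpow_natCast]
          congr 1
          field_simp
          norm_num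
      _ ≤ t ^ (k : ℝ) := Real.rpow_le_rpow_of_exponent_le ht1 hk
      _ = t ^ k := Real.rpow_natCast _ _
  have hf : (0 : ℝ) < k.factorial := by exact_mod_cast k.factorial_pos
  rw [div_le_iff₀ hf] at h1
  rw [Real.exp_neg, mul_one_div, ← div_eq_mul_inv, div_le_div_iff₀ (Real.exp_pos _) (by positivity)]
  nlinarith

/-- Kesten's method: if the distribution family satisfies the Beurling-type
estimate `μ_B({z}) ≤ C·r^{-q}` for all boundary sets `B` of radius at least `r > 1`, then
incremental aggregation satisfies, for some `c > 0`, almost surely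
`rad(F_n) ≤ c·n^{1/(q+1)}` for all sufficiently large `n`. -/
theorem stmt2 {d : ℕ} (hd : 2 ≤ d) {Ω : Type*} [MeasurableSpace Ω]
    (P : Measure Ω) [IsProbabilityMeasure P]
    (μ : Set (Fin d → ℤ) → (Fin d → ℤ) → ℝ) (hμ : IsDistFamily μ)
    (C q : ℝ) (hC : 0 < C) (hq : 0 < q)
    (hBeurling : ∀ r : ℝ, 1 < r → ∀ B : Finset (Fin d → ℤ), IsOuterBdry B →
      r ≤ rad B → ∀ z ∈ B, μ (B : Set (Fin d → ℤ)) z ≤ C * r ^ (-q))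
    (F : ℕ → Ω → Finset (Fin d → ℤ)) (y : ℕ → Ω → (Fin d → ℤ))
    (hagg : IsIncrementalAggregation P μ F y) :
    ∃ c : ℝ, 0 < c ∧
      P {ω | ∃ N : ℕ, ∀ n : ℕ, N ≤ n →
        rad (F n ω) ≤ c * (n : ℝ) ^ ((1 : ℝ) / (q + 1))} = 1 := by
  set D : ℝ := C * ((unitSet d).card * Real.exp 1) with hD
  have hD0 : 0 ≤ D := by positivity
  set s : ℝ := D + 2 with hs
  refine ⟨2 * s, by positivity, ?_⟩
  have hbound : ∀ n : ℕ, 1 ≤ n →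
      P {ω | 2 * s * (n : ℝ) ^ ((1 : ℝ) / (q + 1)) < rad (F n ω)} ≤
        ENNReal.ofReal ((n : ℝ) * Real.exp (-((n : ℝ) ^ ((1 : ℝ) / (q + 1))))) := by
    intro n hn
    have hn1 : (1 : ℝ) ≤ n := by exact_mod_cast hn
    set t : ℝ := (n : ℝ) ^ ((1 : ℝ) / (q + 1)) with ht
    have ht1 : 1 ≤ t := Real.one_le_rpow hn1 (by positivity)
    have ht0 : 0 < t := by linarith
    refine (tail_le hd P μ hμ C q hC hBeurling F y hagg (s * t) (by nlinarith) n hn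
      (2 * s * t) (by positivity)).trans ?_
    apply ENNReal.ofReal_le_ofReal
    gcongr
    have hnt : (n : ℝ) * t ^ (-q) = t := by
      have : (n : ℝ) = t ^ (q + 1) := by
        rw [ht, ← Real.rpow_mul (by positivity), one_div_mul_cancel (by positivity), Real.rpow_one]
      rw [this, ← Real.rpow_add ht0]
      simp
    have hs1 : s ^ (-q) ≤ 1 := Real.rpow_le_one_of_one_le_of_nonpos (by linarith) (by linarith)
    have : (n : ℝ) * (C * (s * t) ^ (-q) * ((unitSet d).card * Real.exp 1)) ≤ D * t := by
      rw [Real.mul_rpow (by positivity) ht0.le]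
      calc _ = D * (s ^ (-q) * (n * t ^ (-q))) := by rw [hD]; ring
        _ = D * (s ^ (-q) * t) := by rw [hnt]
        _ ≤ D * (1 * t) := by gcongr
        _ = D * t := by ring
    have : s * t = D * t + 2 * t := by rw [hs]; ring
    linarith
  have hsum : ∑' n : ℕ, P {ω | 1 ≤ n ∧
      2 * s * (n : ℝ) ^ ((1 : ℝ) / (q + 1)) < rad (F n ω)} ≠ ⊤ := by
    refine ne_top_of_le_ne_top ?_ (ENNReal.tsum_le_tsum
      (g := fun n : ℕ => ENNReal.ofReal ((n : ℝ) *
        Real.exp (-((n : ℝ) ^ ((1 : ℝ) / (q + 1)))))) fun n => ?_)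
    · rw [← ENNReal.ofReal_tsum_of_nonneg (fun n => by positivity) (summable_aux q hq)]
      exact ENNReal.ofReal_ne_top
    · by_cases hn : 1 ≤ n
      · simpa [hn] using hbound n hn
      · simp [hn]
  have hae := measure_setOfPred_frequently_eq_zero hsum
  have huniv : {ω | ∃ N : ℕ, ∀ n : ℕ, N ≤ n →
        rad (F n ω) ≤ 2 * s * (n : ℝ) ^ ((1 : ℝ) / (q + 1))} =ᵐ[P] Set.univ := by
    rw [eventuallyEq_univ]
    have hae' : ∀ᵐ ω ∂P, ¬ ∃ᶠ n : ℕ in atTop, (1 ≤ n ∧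
        2 * s * (n : ℝ) ^ ((1 : ℝ) / (q + 1)) < rad (F n ω)) := by
      rw [ae_iff]
      simpa only [not_not] using hae
    filter_upwards [hae'] with ω hω
    rw [not_frequently] at hω
    obtain ⟨N, hN⟩ := eventually_atTop.1 hω
    refine ⟨max N 1, fun n hn => ?_⟩
    by_contra h
    exact hN n (le_trans (le_max_left _ _) hn) ⟨le_trans (le_max_right _ _) hn, not_le.1 h⟩
  rw [measure_congr huniv, measure_univ]
end

section
/- Let (F_n)_{n∈ℕ} be the Eden growth model in ℤ², i.e. incremental aggregation with distribution family (μ_A) where μ_A is the uniform probability measure on A for each finite nonempty A ⊆ ℤ². Then almost surely lim_{n→∞} log n / log(rad(F_n)) = 2. -/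
open MeasureTheory Filter

open Classical in
/-- The uniform distribution family: `μ_A` is the uniform probability measure on `A`. -/
noncomputable def unifFam {d : ℕ} : Set (Fin d → ℤ) → (Fin d → ℤ) → ℝ :=
  fun A z => if z ∈ A then 1 / (A.ncard : ℝ) else 0


/-- Exponential weight of a point. -/
noncomputable def edW (x : Fin 2 → ℤ) : ℝ := Real.exp (|(x 0 : ℝ)| + |(x 1 : ℝ)|)

/-- Potential of a set. -/
noncomputable def edG (A : Finset (Fin 2 → ℤ)) : ℝ := ∑ x ∈ A, edW x

/-- The four directions. -/
def edD : Finset (Fin 2 → ℤ) := {![1,0], ![-1,0], ![0,1], ![0,-1]}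

lemma edD_card : edD.card ≤ 4 := Finset.card_le_four

lemma adj_mem_edD {x y : Fin 2 → ℤ} (h : adjPt x y) : y - x ∈ edD := by
  unfold adjPt zNorm at h
  rw [Real.sqrt_eq_one, Fin.sum_univ_two] at h
  have h2 : (x 0 - y 0) ^ 2 + (x 1 - y 1) ^ 2 = 1 := by
    have : ((x 0 - y 0 : ℤ) : ℝ) ^ 2 + ((x 1 - y 1 : ℤ) : ℝ) ^ 2 = 1 := by simpa using h
    exact_mod_cast this
  have a1 : x 0 - y 0 ≤ 1 := by nlinarith [sq_nonneg (x 1 - y 1)]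
  have a2 : -1 ≤ x 0 - y 0 := by nlinarith [sq_nonneg (x 1 - y 1)]
  have b1 : x 1 - y 1 ≤ 1 := by nlinarith [sq_nonneg (x 0 - y 0)]
  have b2 : -1 ≤ x 1 - y 1 := by nlinarith [sq_nonneg (x 0 - y 0)]
  have e : y - x = ![y 0 - x 0, y 1 - x 1] := by
    ext i; fin_cases i <;> simp
  rw [e]
  generalize hu : x 0 - y 0 = u at *
  generalize hv : x 1 - y 1 = v at *
  have e0 : y 0 - x 0 = -u := by omega
  have e1 : y 1 - x 1 = -v := by omega
  rw [e0, e1]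
  interval_cases u <;> interval_cases v <;> simp_all [edD]

lemma obdry_sub (A : Finset (Fin 2 → ℤ)) :
    obdry (A : Set (Fin 2 → ℤ)) ⊆
      (((A ×ˢ edD).image (fun p => p.1 + p.2) : Finset (Fin 2 → ℤ)) : Set (Fin 2 → ℤ)) := by
  rintro y ⟨_, x, hx, hxy⟩
  simp only [Finset.coe_image, Set.mem_image, Finset.mem_coe, Finset.mem_product]
  exact ⟨(x, y - x), ⟨hx, adj_mem_edD hxy⟩, by simp⟩

lemma obdry_fin (A : Finset (Fin 2 → ℤ)) : (obdry (A : Set (Fin 2 → ℤ))).Finite :=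
  (Finset.finite_toSet _).subset (obdry_sub A)

lemma edW_pos (x : Fin 2 → ℤ) : 0 < edW x := Real.exp_pos _

lemma edG_nonneg (A : Finset (Fin 2 → ℤ)) : 0 ≤ edG A :=
  Finset.sum_nonneg fun x _ => (edW_pos x).le

lemma edW_add (x d : Fin 2 → ℤ) (hd : d ∈ edD) : edW (x + d) ≤ 3 * edW x := by
  have h3 : Real.exp 1 ≤ 3 := by linarith [Real.exp_one_lt_d9]
  have key : |((x + d) 0 : ℝ)| + |((x + d) 1 : ℝ)| ≤ 1 + (|(x 0 : ℝ)| + |(x 1 : ℝ)|) := by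
    have k0 := abs_add_le (x 0 : ℝ) (d 0)
    have k1 := abs_add_le (x 1 : ℝ) (d 1)
    have kd : |(d 0 : ℝ)| + |(d 1 : ℝ)| = 1 := by
      simp only [edD, Finset.mem_insert, Finset.mem_singleton] at hd
      rcases hd with rfl | rfl | rfl | rfl <;> simp
    simp only [Pi.add_apply, Int.cast_add]
    linarith
  calc edW (x + d) ≤ Real.exp (1 + (|(x 0 : ℝ)| + |(x 1 : ℝ)|)) := Real.exp_le_exp.2 key
    _ = Real.exp 1 * edW x := by rw [Real.exp_add]; rfl
    _ ≤ 3 * edW x := by gcongr; exact (edW_pos x).le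

lemma sum_bdry (A : Finset (Fin 2 → ℤ)) :
    ∑ v ∈ (obdry_fin A).toFinset, edW v ≤ 12 * edG A := by
  have hs : (obdry_fin A).toFinset ⊆ (A ×ˢ edD).image (fun p => p.1 + p.2) := by
    intro v hv
    have := obdry_sub A ((obdry_fin A).mem_toFinset.1 hv)
    exact_mod_cast this
  calc ∑ v ∈ (obdry_fin A).toFinset, edW v
      ≤ ∑ v ∈ (A ×ˢ edD).image (fun p => p.1 + p.2), edW v :=
        Finset.sum_le_sum_of_subset_of_nonneg hs fun v _ _ => (edW_pos v).le
    _ ≤ ∑ p ∈ A ×ˢ edD, edW (p.1 + p.2) :=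
        Finset.sum_image_le_of_nonneg fun v _ => (edW_pos _).le
    _ = ∑ x ∈ A, ∑ d ∈ edD, edW (x + d) := Finset.sum_product _ _ _
    _ ≤ ∑ x ∈ A, ∑ d ∈ edD, 3 * edW x :=
        Finset.sum_le_sum fun x _ => Finset.sum_le_sum fun d hd => edW_add x d hd
    _ = ∑ x ∈ A, (edD.card : ℝ) * (3 * edW x) := by simp
    _ ≤ ∑ x ∈ A, 12 * edW x := by
        refine Finset.sum_le_sum fun x _ => ?_
        have : (edD.card : ℝ) ≤ 4 := by exact_mod_cast edD_card
        nlinarith [edW_pos x]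
    _ = 12 * edG A := by rw [edG, Finset.mul_sum]

lemma proj_card (A : Finset (Fin 2 → ℤ)) (i j : Fin 2) (hij : i ≠ j) :
    (A.image (fun x => x i)).card ≤ (obdry (A : Set (Fin 2 → ℤ))).ncard := by
  have hsub : A.image (fun x => x i) ⊆ (obdry_fin A).toFinset.image (fun x => x i) := by
    intro c hc
    obtain ⟨x0, hx0, rfl⟩ := Finset.mem_image.1 hc
    obtain ⟨x, hx, hmax⟩ := (A.filter (fun x => x i = x0 i)).exists_max_image (fun x => x j)
      ⟨x0, by simp [hx0]⟩
    rw [Finset.mem_filter] at hx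
    refine Finset.mem_image.2 ⟨x + Pi.single j 1, ?_, ?_⟩
    · rw [Set.Finite.mem_toFinset]
      refine ⟨fun hmem => ?_, x, hx.1, ?_⟩
      · have := hmax (x + Pi.single j 1) (by
          rw [Finset.mem_filter]
          exact ⟨hmem, by simp [hij, hx.2]⟩)
        simp at this
      · unfold adjPt zNorm
        rw [Real.sqrt_eq_one]
        fin_cases j <;> simp
    · simp [hij, hx.2]
  calc _ ≤ _ := Finset.card_le_card hsub
    _ ≤ _ := Finset.card_image_le
    _ = _ := (Set.ncard_eq_toFinset_card _ _).symm

lemma card_le_sq (A : Finset (Fin 2 → ℤ)) :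
    A.card ≤ (obdry (A : Set (Fin 2 → ℤ))).ncard ^ 2 := by
  have h : A.card ≤ ((A.image (fun x => x 0)) ×ˢ (A.image (fun x => x 1))).card := by
    refine Finset.card_le_card_of_injOn (fun x => (x 0, x 1)) ?_ ?_
    · intro x hx
      simp only [Finset.coe_product, Set.mem_prod, Finset.mem_coe]
      exact ⟨Finset.mem_image_of_mem _ hx, Finset.mem_image_of_mem _ hx⟩
    · intro x _ y _ hxy
      simp only [Prod.mk.injEq] at hxy
      ext i; fin_cases i
      · exact hxy.1
      · exact hxy.2
  rw [Finset.card_product] at h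
  have h0 := proj_card A 0 1 (by decide)
  have h1 := proj_card A 1 0 (by decide)
  nlinarith

lemma step_pot (A : Finset (Fin 2 → ℤ)) (hA : A.Nonempty) :
    ∑' v, ENNReal.ofReal (unifFam (obdry (A : Set (Fin 2 → ℤ))) v) *
      ENNReal.ofReal (edG (insert v A)) ≤
    ENNReal.ofReal ((1 + 12 / Real.sqrt A.card) * edG A) := by
  classical
  set B := (obdry_fin A).toFinset with hB
  set N : ℝ := ((obdry (A : Set (Fin 2 → ℤ))).ncard : ℝ) with hN
  have hcard : (B.card : ℝ) = N := by
    rw [hN, Set.ncard_eq_toFinset_card _ (obdry_fin A)]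
  have hAc : (0 : ℝ) < Real.sqrt A.card := Real.sqrt_pos.2 (by exact_mod_cast hA.card_pos)
  have hsq : Real.sqrt A.card ≤ N := by
    rw [Real.sqrt_le_left (by positivity)]
    rw [hN]; exact_mod_cast card_le_sq A
  have hNpos : 0 < N := lt_of_lt_of_le hAc hsq
  have hu : ∀ v ∈ B, unifFam (obdry (A : Set (Fin 2 → ℤ))) v = 1 / N := by
    intro v hv
    rw [hB, Set.Finite.mem_toFinset] at hv
    simp [unifFam, hv, hN]
  rw [tsum_eq_sum (s := B)]
  · have : ∀ v ∈ B, ENNReal.ofReal (unifFam (obdry (A : Set (Fin 2 → ℤ))) v) *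
      ENNReal.ofReal (edG (insert v A)) = ENNReal.ofReal (1 / N * (edG A + edW v)) := by
      intro v hv
      rw [hu v hv, ← ENNReal.ofReal_mul (by positivity)]
      have hv' : v ∉ A := by
        rw [hB, Set.Finite.mem_toFinset] at hv
        exact fun h => hv.1 h
      congr 2
      rw [edG, Finset.sum_insert hv', add_comm]; rfl
    rw [Finset.sum_congr rfl this, ← ENNReal.ofReal_sum_of_nonneg]
    · apply ENNReal.ofReal_le_ofReal
      rw [← Finset.mul_sum, Finset.sum_add_distrib, Finset.sum_const, nsmul_eq_mul, hcard]
      have h1 := sum_bdry A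
      have hg := edG_nonneg A
      calc 1 / N * (N * edG A + ∑ v ∈ B, edW v) ≤ 1 / N * (N * edG A + 12 * edG A) := by
            gcongr
        _ = (1 + 12 / N) * edG A := by field_simp
        _ ≤ _ := by gcongr
    · intro v _
      have := edG_nonneg A
      have := edW_pos v
      positivity
  · intro v hv
    have : v ∉ obdry (A : Set (Fin 2 → ℤ)) := by
      rwa [hB, Set.Finite.mem_toFinset] at hv
    simp [unifFam, this]

section proc
variable {Ω : Type*} [MeasurableSpace Ω] (P : Measure Ω)
    (F : ℕ → Ω → Finset (Fin 2 → ℤ)) (y : ℕ → Ω → (Fin 2 → ℤ))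

lemma step_gen (hagg : IsIncrementalAggregation P unifFam F y) (n : ℕ) (hn : 1 ≤ n)
    (f : Finset (Fin 2 → ℤ) → ENNReal) :
    ∑' B, f B * P {ω | F (n + 1) ω = B} ≤
      ∑' A : Finset (Fin 2 → ℤ), (∑' v, ENNReal.ofReal (unifFam (obdry (A : Set (Fin 2 → ℤ))) v)
        * f (insert v A)) * P {ω | F n ω = A} := by
  classical
  obtain ⟨-, hins, hlaw⟩ := hagg
  have h1 : ∀ B, P {ω | F (n + 1) ω = B} ≤ ∑' A, ∑' v,
      (if B = insert v A then P ({ω | y (n + 1) ω = v} ∩ {ω | F n ω = A}) else 0) := by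
    intro B
    calc P {ω | F (n + 1) ω = B}
        ≤ P (⋃ A, ⋃ v, if B = insert v A then
            ({ω | y (n + 1) ω = v} ∩ {ω | F n ω = A}) else ∅) := by
          refine measure_mono fun ω hω => ?_
          simp only [Set.mem_ofPred_eq] at hω
          simp only [Set.mem_iUnion]
          refine ⟨F n ω, y (n + 1) ω, ?_⟩
          rw [if_pos (by rw [← hω, hins n hn])]
          exact ⟨rfl, rfl⟩
      _ ≤ ∑' A, P (⋃ v, if B = insert v A then
            ({ω | y (n + 1) ω = v} ∩ {ω | F n ω = A}) else ∅) := measure_iUnion_le _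
      _ ≤ ∑' A, ∑' v, P (if B = insert v A then
            ({ω | y (n + 1) ω = v} ∩ {ω | F n ω = A}) else ∅) :=
          ENNReal.tsum_le_tsum fun A => measure_iUnion_le _
      _ = _ := by
          refine tsum_congr fun A => tsum_congr fun v => ?_
          split_ifs <;> simp
  calc ∑' B, f B * P {ω | F (n + 1) ω = B}
      ≤ ∑' B, f B * ∑' A, ∑' v,
      (if B = insert v A then P ({ω | y (n + 1) ω = v} ∩ {ω | F n ω = A}) else 0) := by
        refine ENNReal.tsum_le_tsum fun B => ?_
        gcongr
        exact h1 B
    _ = ∑' B, ∑' A, ∑' v, (if B = insert v A then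
          f B * P ({ω | y (n + 1) ω = v} ∩ {ω | F n ω = A}) else 0) := by
        refine tsum_congr fun B => ?_
        rw [← ENNReal.tsum_mul_left]
        refine tsum_congr fun A => ?_
        rw [← ENNReal.tsum_mul_left]
        refine tsum_congr fun v => ?_
        rw [mul_ite, mul_zero]
    _ = ∑' A, ∑' v, ∑' B, (if B = insert v A then
          f B * P ({ω | y (n + 1) ω = v} ∩ {ω | F n ω = A}) else 0) := by
        rw [ENNReal.tsum_comm]
        exact tsum_congr fun A => ENNReal.tsum_comm
    _ = _ := by
        refine tsum_congr fun A => ?_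
        rw [← ENNReal.tsum_mul_right]
        refine tsum_congr fun v => ?_
        rw [tsum_ite_eq, hlaw n hn]
        ring

lemma card_null (hagg : IsIncrementalAggregation P unifFam F y) (n : ℕ) (hn : 1 ≤ n) :
    ∀ A : Finset (Fin 2 → ℤ), A.card ≠ n → P {ω | F n ω = A} = 0 := by
  classical
  induction n, hn using Nat.le_induction with
  | base =>
    intro A hA
    refine measure_mono_null ?_ (ae_iff.1 hagg.1)
    rintro ω (hω : F 1 ω = A) ⟨h, -⟩
    rw [← hω, h] at hA
    simp at hA
  | succ n hn ih =>
    have h := step_gen P F y hagg n hn (fun B => if B.card ≠ n + 1 then 1 else 0)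
    have h0 : ∑' A : Finset (Fin 2 → ℤ),
        (∑' v, ENNReal.ofReal (unifFam (obdry (A : Set (Fin 2 → ℤ))) v)
        * (if (insert v A).card ≠ n + 1 then 1 else 0)) * P {ω | F n ω = A} = 0 := by
      rw [ENNReal.tsum_eq_zero]
      intro A
      by_cases hA : A.card = n
      · refine mul_eq_zero.2 (Or.inl ?_)
        rw [ENNReal.tsum_eq_zero]
        intro v
        by_cases hv : v ∈ obdry (A : Set (Fin 2 → ℤ))
        · have : v ∉ A := fun h => hv.1 h
          simp [Finset.card_insert_of_notMem this, hA]
        · simp [unifFam, hv]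
      · rw [ih A hA, mul_zero]
    rw [h0, nonpos_iff_eq_zero, ENNReal.tsum_eq_zero] at h
    intro B hB
    simpa [hB] using h B

lemma sqrt_step (n : ℕ) (hn : 1 ≤ n) :
    (1 + 12 / Real.sqrt n) * Real.exp (36 * Real.sqrt n) ≤
      Real.exp (36 * Real.sqrt ((n + 1 : ℕ) : ℝ)) := by
  have hn' : (1 : ℝ) ≤ n := by exact_mod_cast hn
  set s := Real.sqrt n with hs
  set t := Real.sqrt ((n + 1 : ℕ) : ℝ) with ht
  have hs1 : 1 ≤ s := Real.one_le_sqrt.2 hn'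
  have hs2 : s ^ 2 = n := Real.sq_sqrt (by positivity)
  have ht2 : t ^ 2 = n + 1 := by
    rw [ht, Real.sq_sqrt (by positivity)]; push_cast; ring
  have ht0 : 0 ≤ t := Real.sqrt_nonneg _
  have hts : t ≤ 2 * s := by nlinarith
  have hst : s ≤ t := by nlinarith
  have key : 12 / s ≤ 36 * (t - s) := by
    rw [div_le_iff₀ (by linarith)]
    nlinarith [mul_nonneg (sub_nonneg.2 hst) (sub_nonneg.2 hts)]
  calc (1 + 12 / s) * Real.exp (36 * s)
      ≤ Real.exp (36 * (t - s)) * Real.exp (36 * s) := by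
        gcongr
        linarith [Real.add_one_le_exp (36 * (t - s))]
    _ = Real.exp (36 * t) := by rw [← Real.exp_add]; ring_nf

lemma pot_bound [IsProbabilityMeasure P]
    (hagg : IsIncrementalAggregation P unifFam F y) (n : ℕ) (hn : 1 ≤ n) :
    ∑' A, ENNReal.ofReal (edG A) * P {ω | F n ω = A} ≤
      ENNReal.ofReal (Real.exp (36 * Real.sqrt n)) := by
  induction n, hn using Nat.le_induction with
  | base =>
    rw [tsum_eq_single {0}]
    · have : edG {0} = 1 := by simp [edG, edW]
      rw [this]
      calc ENNReal.ofReal 1 * P {ω | F 1 ω = {0}} ≤ ENNReal.ofReal 1 * 1 := by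
            gcongr; exact prob_le_one
        _ = ENNReal.ofReal 1 := mul_one _
        _ ≤ _ := ENNReal.ofReal_le_ofReal (Real.one_le_exp (by positivity))
    · intro A hA
      have : P {ω | F 1 ω = A} = 0 := by
        refine measure_mono_null ?_ (ae_iff.1 hagg.1)
        rintro ω (hω : F 1 ω = A) ⟨h, -⟩
        exact hA (hω ▸ h)
      rw [this, mul_zero]
  | succ n hn ih =>
    refine (step_gen P F y hagg n hn (fun A => ENNReal.ofReal (edG A))).trans ?_
    have hb : ∀ A : Finset (Fin 2 → ℤ),
        (∑' v, ENNReal.ofReal (unifFam (obdry (A : Set (Fin 2 → ℤ))) v)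
        * ENNReal.ofReal (edG (insert v A))) * P {ω | F n ω = A} ≤
        ENNReal.ofReal (1 + 12 / Real.sqrt n) *
          (ENNReal.ofReal (edG A) * P {ω | F n ω = A}) := by
      intro A
      by_cases hA : A.card = n
      · have hne : A.Nonempty := Finset.card_pos.1 (by omega)
        have h := step_pot A hne
        rw [hA, ENNReal.ofReal_mul (by positivity)] at h
        rw [← mul_assoc]
        gcongr
      · rw [card_null P F y hagg n hn A hA]; simp
    calc _ ≤ ∑' A, ENNReal.ofReal (1 + 12 / Real.sqrt n) *
          (ENNReal.ofReal (edG A) * P {ω | F n ω = A}) := ENNReal.tsum_le_tsum hb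
      _ = ENNReal.ofReal (1 + 12 / Real.sqrt n) *
          ∑' A, (ENNReal.ofReal (edG A) * P {ω | F n ω = A}) := ENNReal.tsum_mul_left
      _ ≤ ENNReal.ofReal (1 + 12 / Real.sqrt n) *
          ENNReal.ofReal (Real.exp (36 * Real.sqrt n)) := by gcongr
      _ = ENNReal.ofReal ((1 + 12 / Real.sqrt n) * Real.exp (36 * Real.sqrt n)) := by
          rw [ENNReal.ofReal_mul (by positivity)]
      _ ≤ _ := ENNReal.ofReal_le_ofReal (sqrt_step n hn)

lemma zNorm_le (x : Fin 2 → ℤ) : zNorm x ≤ |(x 0 : ℝ)| + |(x 1 : ℝ)| := by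
  unfold zNorm
  rw [Fin.sum_univ_two, Real.sqrt_le_left (by positivity)]
  nlinarith [sq_abs (x 0 : ℝ), sq_abs (x 1 : ℝ), abs_nonneg (x 0 : ℝ), abs_nonneg (x 1 : ℝ),
    mul_nonneg (abs_nonneg (x 0 : ℝ)) (abs_nonneg (x 1 : ℝ))]

lemma exp_rad_le (A : Finset (Fin 2 → ℤ)) (hA : A.Nonempty) : Real.exp (rad A) ≤ edG A := by
  unfold rad
  rw [dif_pos hA]
  obtain ⟨x, hx, he⟩ := Finset.exists_mem_eq_sup' hA zNorm
  rw [he]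
  calc Real.exp (zNorm x) ≤ edW x := Real.exp_le_exp.2 (zNorm_le x)
    _ ≤ edG A := Finset.single_le_sum (f := edW) (fun v _ => (edW_pos v).le) hx

lemma tail_bound [IsProbabilityMeasure P]
    (hagg : IsIncrementalAggregation P unifFam F y) (n : ℕ) (hn : 1 ≤ n) :
    P {ω | 40 * Real.sqrt n ≤ rad (F n ω)} ≤ ENNReal.ofReal (1 / (n : ℝ) ^ 2) := by
  classical
  set s := Real.sqrt n with hs
  have hn' : (1 : ℝ) ≤ n := by exact_mod_cast hn
  have hs1 : 1 ≤ s := Real.one_le_sqrt.2 hn'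
  have hs2 : s ^ 2 = n := Real.sq_sqrt (by positivity)
  have hE : Real.exp (-(40 * s)) * Real.exp (36 * s) ≤ 1 / (n : ℝ) ^ 2 := by
    have h1 : s ≤ Real.exp s := by linarith [Real.add_one_le_exp s]
    have h2 : (n : ℝ) ^ 2 ≤ Real.exp (4 * s) := by
      calc (n : ℝ) ^ 2 = s ^ 4 := by rw [← hs2]; ring
        _ ≤ (Real.exp s) ^ 4 := by gcongr
        _ = Real.exp (4 * s) := by rw [← Real.exp_nat_mul]; norm_num
    rw [← Real.exp_add, show -(40 * s) + 36 * s = -(4 * s) by ring, Real.exp_neg, ← one_div]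
    gcongr
  calc P {ω | 40 * s ≤ rad (F n ω)}
      ≤ P (⋃ A : Finset (Fin 2 → ℤ), if 40 * s ≤ rad A then {ω | F n ω = A} else ∅) := by
        refine measure_mono fun ω (hω : 40 * s ≤ rad (F n ω)) => ?_
        simp only [Set.mem_iUnion]
        refine ⟨F n ω, ?_⟩
        rw [if_pos hω]; rfl
    _ ≤ ∑' A : Finset (Fin 2 → ℤ), P (if 40 * s ≤ rad A then {ω | F n ω = A} else ∅) :=
        measure_iUnion_le _
    _ ≤ ∑' A : Finset (Fin 2 → ℤ), ENNReal.ofReal (Real.exp (-(40 * s))) *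
          (ENNReal.ofReal (edG A) * P {ω | F n ω = A}) := by
        refine ENNReal.tsum_le_tsum fun A => ?_
        split_ifs with h
        · have hne : A.Nonempty := by
            by_contra hne
            unfold rad at h
            rw [dif_neg hne] at h
            linarith
          rw [← mul_assoc, ← ENNReal.ofReal_mul (by positivity)]
          have : (1 : ℝ) ≤ Real.exp (-(40 * s)) * edG A := by
            calc (1 : ℝ) = Real.exp (-(40 * s)) * Real.exp (40 * s) := by
                  rw [← Real.exp_add]; simp
              _ ≤ Real.exp (-(40 * s)) * edG A := by
                  gcongr
                  exact (Real.exp_le_exp.2 h).trans (exp_rad_le A hne)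
          exact le_mul_of_one_le_left (zero_le) (by simpa using this)
        · simp
    _ = ENNReal.ofReal (Real.exp (-(40 * s))) *
          ∑' A, (ENNReal.ofReal (edG A) * P {ω | F n ω = A}) := ENNReal.tsum_mul_left
    _ ≤ ENNReal.ofReal (Real.exp (-(40 * s))) * ENNReal.ofReal (Real.exp (36 * s)) := by
        gcongr
        exact pot_bound P F y hagg n hn
    _ = ENNReal.ofReal (Real.exp (-(40 * s)) * Real.exp (36 * s)) := by
        rw [ENNReal.ofReal_mul (by positivity)]
    _ ≤ _ := ENNReal.ofReal_le_ofReal hE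

end proc

lemma rad_nonneg' (A : Finset (Fin 2 → ℤ)) : 0 ≤ rad A := by
  unfold rad
  split_ifs with h
  · obtain ⟨x, hx⟩ := h
    exact (Real.sqrt_nonneg _).trans (Finset.le_sup' zNorm hx)
  · exact le_rfl

lemma coord_le (A : Finset (Fin 2 → ℤ)) (x) (hx : x ∈ A) (i : Fin 2) : |(x i : ℝ)| ≤ rad A := by
  have h1 : zNorm x ≤ rad A := by
    unfold rad
    rw [dif_pos ⟨x, hx⟩]
    exact Finset.le_sup' zNorm hx
  refine le_trans ?_ h1
  unfold zNorm
  apply Real.abs_le_sqrt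
  exact Finset.single_le_sum (f := fun i => (x i : ℝ) ^ 2) (fun _ _ => sq_nonneg _)
    (Finset.mem_univ i)

lemma card_le_rad (A : Finset (Fin 2 → ℤ)) : (A.card : ℝ) ≤ (2 * rad A + 1) ^ 2 := by
  set m := ⌊rad A⌋ with hm
  have hm0 : 0 ≤ m := Int.floor_nonneg.2 (rad_nonneg' A)
  have hc : ∀ x ∈ A, ∀ i, x i ∈ Finset.Icc (-m) m := by
    intro x hx i
    have h := coord_le A x hx i
    have : |x i| ≤ m := Int.le_floor.2 (by push_cast; exact h)
    rw [Finset.mem_Icc]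
    exact abs_le.1 this
  have h : A.card ≤ ((Finset.Icc (-m) m) ×ˢ (Finset.Icc (-m) m)).card := by
    refine Finset.card_le_card_of_injOn (fun x => (x 0, x 1)) ?_ ?_
    · intro x hx
      simp only [Finset.coe_product, Set.mem_prod, Finset.mem_coe]
      exact ⟨hc x hx 0, hc x hx 1⟩
    · intro x _ y _ hxy
      simp only [Prod.mk.injEq] at hxy
      ext i; fin_cases i
      · exact hxy.1
      · exact hxy.2
  rw [Finset.card_product, Int.card_Icc] at h
  have h2 : (((m + 1 - -m).toNat : ℕ) : ℝ) = 2 * m + 1 := by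
    have : (((m + 1 - -m).toNat : ℕ) : ℤ) = 2 * m + 1 := by omega
    exact_mod_cast this
  have h3 : (A.card : ℝ) ≤ (2 * m + 1) * (2 * m + 1) := by
    rw [← h2]; exact_mod_cast h
  have h4 : (m : ℝ) ≤ rad A := Int.floor_le _
  have h5 : (0 : ℝ) ≤ m := by exact_mod_cast hm0
  nlinarith

lemma final_lim (r : ℕ → ℝ) (h0 : ∀ n, 0 ≤ r n)
    (h1 : ∀ᶠ n : ℕ in atTop, (n : ℝ) ≤ (2 * r n + 1) ^ 2)
    (h2 : ∀ᶠ n : ℕ in atTop, r n < 40 * Real.sqrt n) :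
    Tendsto (fun n : ℕ => Real.log n / Real.log (r n)) atTop (nhds 2) := by
  have hlog : Tendsto (fun n : ℕ => Real.log (n : ℝ)) atTop atTop :=
    Real.tendsto_log_atTop.comp tendsto_natCast_atTop_atTop
  have hL : ∀ c : ℝ, Tendsto (fun n : ℕ => 1 / 2 + c / Real.log (n : ℝ)) atTop (nhds (1 / 2)) := by
    intro c
    simpa using (tendsto_const_nhds (x := (1 / 2 : ℝ))).add (hlog.const_div_atTop c)
  have key : Tendsto (fun n : ℕ => Real.log (r n) / Real.log n) atTop (nhds (1 / 2)) := by
    refine tendsto_of_tendsto_of_tendsto_of_le_of_le' (hL (-Real.log 4)) (hL (Real.log 40)) ?_ ?_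
    all_goals
      filter_upwards [h1, h2, eventually_ge_atTop 4] with n a b hn
      have hn' : (4 : ℝ) ≤ n := by exact_mod_cast hn
      have hlp : 0 < Real.log (n : ℝ) := Real.log_pos (by linarith)
      have hs2 : Real.sqrt n ^ 2 = n := Real.sq_sqrt (by positivity)
      have hs : 2 ≤ Real.sqrt n := Real.le_sqrt_of_sq_le (by linarith)
      have hls : Real.log (Real.sqrt n) = Real.log n / 2 := Real.log_sqrt (by positivity)
      have hr := h0 n
      have hlow : Real.sqrt n / 4 ≤ r n := by
        have : Real.sqrt n ≤ 2 * r n + 1 := abs_le_of_sq_le_sq' (by rw [hs2]; exact a) (by linarith) |>.2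
        linarith
    · rw [le_div_iff₀ hlp]
      have := Real.log_le_log (by positivity) hlow
      rw [Real.log_div (by positivity) (by norm_num), hls] at this
      have e : (1 / 2 + -Real.log 4 / Real.log n) * Real.log n = Real.log n / 2 - Real.log 4 := by
        field_simp; ring
      rw [e]; exact this
    · rw [div_le_iff₀ hlp]
      have := Real.log_le_log (by linarith) b.le
      rw [Real.log_mul (by norm_num) (by positivity), hls] at this
      have e : (1 / 2 + Real.log 40 / Real.log n) * Real.log n = Real.log n / 2 + Real.log 40 := by
        field_simp
      rw [e]; linarith
  have := key.inv₀ (by norm_num)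
  simpa using this

/-- for the Eden growth model in `ℤ²`, almost surely
`log n / log(rad F_n) → 2`, i.e. the fractal dimension equals 2. -/
theorem stmt5 {Ω : Type*} [MeasurableSpace Ω]
    (P : Measure Ω) [IsProbabilityMeasure P]
    (F : ℕ → Ω → Finset (Fin 2 → ℤ)) (y : ℕ → Ω → (Fin 2 → ℤ))
    (hagg : IsIncrementalAggregation P unifFam F y) :
    ∀ᵐ ω ∂P, Filter.Tendsto
      (fun n : ℕ => Real.log n / Real.log (rad (F n ω)))
      Filter.atTop (nhds 2) := by
  have hcard : ∀ᵐ ω ∂P, ∀ n : ℕ, 1 ≤ n → (F n ω).card = n := by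
    rw [ae_all_iff]
    intro n
    by_cases hn : 1 ≤ n
    · have : ∀ᵐ ω ∂P, ∀ A : Finset (Fin 2 → ℤ), A.card ≠ n → F n ω ≠ A := by
        rw [ae_all_iff]
        intro A
        by_cases hA : A.card = n
        · exact Eventually.of_forall fun ω h => absurd hA h
        · have h0 := card_null P F y hagg n hn A hA
          have : ∀ᵐ ω ∂P, F n ω ≠ A := by
            rw [ae_iff]; simpa using h0
          exact this.mono fun ω h _ => h
      refine this.mono fun ω h _ => ?_
      by_contra hne
      exact h _ hne rfl
    · exact Eventually.of_forall fun ω h => absurd h hn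
  have hbc : ∀ᵐ ω ∂P, ∀ᶠ n : ℕ in atTop,
      ω ∉ {ω | 1 ≤ n ∧ 40 * Real.sqrt n ≤ rad (F n ω)} := by
    apply ae_eventually_notMem
    have hsum : Summable (fun n : ℕ => 1 / (n : ℝ) ^ 2) :=
      Real.summable_one_div_nat_pow.2 (by norm_num)
    refine ne_top_of_le_ne_top hsum.tsum_ofReal_ne_top (ENNReal.tsum_le_tsum fun n => ?_)
    by_cases hn : 1 ≤ n
    · simpa [hn] using tail_bound P F y hagg n hn
    · simp [hn]
  filter_upwards [hcard, hbc] with ω hc hb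
  refine final_lim (fun n => rad (F n ω)) (fun n => rad_nonneg' _) ?_ ?_
  · filter_upwards [eventually_ge_atTop 1] with n hn
    have := card_le_rad (F n ω)
    rwa [hc n hn] at this
  · filter_upwards [eventually_ge_atTop 1, hb] with n hn h
    by_contra hcon
    exact h ⟨hn, not_lt.1 hcon⟩
end
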